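/- If (A, H, ▷, ◁) is a matched pair of Hopf algebras over a field k with H cocommutative, then the tensor product coalgebra A ⊗ H, equipped with the two multiplications (a ⊗ x)(b ⊗ y) = a(x₍₁₎ ▷ b₍₁₎) ⊗ (x₍₂₎ ◁ b₍₂₎)y (the bicrossed product multiplication) and (a ⊗ x) ∘ (b ⊗ y) = ab ⊗ yx, is a Hopf brace. -/

import Mathlib

/-! Common definitions for formalizing "Constructing Hopf braces" (Agore). -/

open TensorProduct LinearMap

namespace HopfBraceNL

universe u

variable (k : Type u) [Field k]

section HopfStr

variable (V : Type u) [AddCommGroup V] [Module k V] [Coalgebra k V]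

/-- The coalgebra `V` is cocommutative. -/
def IsCocomm : Prop :=
  (TensorProduct.comm k V V).toLinearMap ∘ₗ (Coalgebra.comul (R := k) (A := V)) =
    Coalgebra.comul (R := k) (A := V)

/-- A Hopf algebra structure on the underlying coalgebra of `V`: a multiplication, unit and
antipode making `V` a Hopf algebra whose comultiplication and counit are the given ones. -/
structure HopfStr where
  mul : V ⊗[k] V →ₗ[k] V
  one : V
  mul_assoc : ∀ a b c : V, mul (mul (a ⊗ₜ[k] b) ⊗ₜ[k] c) = mul (a ⊗ₜ[k] mul (b ⊗ₜ[k] c))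
  one_mul : ∀ a : V, mul (one ⊗ₜ[k] a) = a
  mul_one : ∀ a : V, mul (a ⊗ₜ[k] one) = a
  comul_mul : ∀ a b : V,
    Coalgebra.comul (R := k) (mul (a ⊗ₜ[k] b)) =
      TensorProduct.map mul mul
        (TensorProduct.tensorTensorTensorComm k V V V V
          (Coalgebra.comul (R := k) a ⊗ₜ[k] Coalgebra.comul (R := k) b))
  counit_mul : ∀ a b : V,
    Coalgebra.counit (R := k) (mul (a ⊗ₜ[k] b)) =
      Coalgebra.counit (R := k) a * Coalgebra.counit (R := k) b
  comul_one : Coalgebra.comul (R := k) one = one ⊗ₜ[k] one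
  counit_one : Coalgebra.counit (R := k) one = 1
  antipode : V →ₗ[k] V
  antipode_left :
    mul ∘ₗ rTensor V antipode ∘ₗ Coalgebra.comul =
      toSpanSingleton k V one ∘ₗ Coalgebra.counit
  antipode_right :
    mul ∘ₗ lTensor V antipode ∘ₗ Coalgebra.comul =
      toSpanSingleton k V one ∘ₗ Coalgebra.counit

variable {k V}

/-- The Hopf structure is commutative. -/
def HopfStr.IsComm (hs : HopfStr k V) : Prop :=
  ∀ x y : V, hs.mul (x ⊗ₜ[k] y) = hs.mul (y ⊗ₜ[k] x)

/-- The linear map `x ⊗ y ⊗ z ↦ (x₍₁₎ ∘ y)·S(x₍₂₎)·(x₍₃₎ ∘ z)` (Sweedler notation), the right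
hand side of the Hopf brace compatibility condition, written point-free.  Here `m` and `S` are
the multiplication and antipode of the first Hopf structure and `m'` the multiplication of the
second one. -/
noncomputable def braceRHS (m : V ⊗[k] V →ₗ[k] V) (S : V →ₗ[k] V)
    (m' : V ⊗[k] V →ₗ[k] V) : V ⊗[k] (V ⊗[k] V) →ₗ[k] V :=
  m ∘ₗ lTensor V m
    ∘ₗ TensorProduct.map m' (TensorProduct.map S m')
    ∘ₗ lTensor (V ⊗[k] V) (TensorProduct.assoc k V V V).toLinearMap
    ∘ₗ (TensorProduct.tensorTensorTensorComm k V (V ⊗[k] V) V V).toLinearMap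
    ∘ₗ rTensor (V ⊗[k] V)
        ((lTensor V (Coalgebra.comul (R := k))) ∘ₗ (Coalgebra.comul (R := k) (A := V)))

variable (k V) in
/-- A Hopf brace on the coalgebra `V`: two Hopf algebra structures subject to the compatibility
`x ∘ (y·z) = (x₍₁₎ ∘ y)·S(x₍₂₎)·(x₍₃₎ ∘ z)`. -/
structure HopfBrace where
  dot : HopfStr k V
  circ : HopfStr k V
  brace : circ.mul ∘ₗ lTensor V dot.mul = braceRHS dot.mul dot.antipode circ.mul

/-- A solution of the braid equation on `V ⊗ V`. -/
def SolvesBraid {W : Type u} [AddCommGroup W] [Module k W]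
    (c : W ⊗[k] W →ₗ[k] W ⊗[k] W) : Prop :=
  letI c₁ : (W ⊗[k] W) ⊗[k] W →ₗ[k] (W ⊗[k] W) ⊗[k] W := rTensor W c
  letI c₂ : (W ⊗[k] W) ⊗[k] W →ₗ[k] (W ⊗[k] W) ⊗[k] W :=
    (TensorProduct.assoc k W W W).symm.toLinearMap ∘ₗ lTensor W c ∘ₗ
      (TensorProduct.assoc k W W W).toLinearMap
  c₁ ∘ₗ c₂ ∘ₗ c₁ = c₂ ∘ₗ c₁ ∘ₗ c₂

end HopfStr

section Actions

variable {k}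
variable {A H : Type u}
  [AddCommGroup A] [Module k A] [Coalgebra k A]
  [AddCommGroup H] [Module k H] [Coalgebra k H]

/-- `(x, a) ↦ (x₍₁₎ ⊗ a₍₁₎) ⊗ (x₍₂₎ ⊗ a₍₂₎)`, as an element. -/
noncomputable def split (x : H) (a : A) : (H ⊗[k] A) ⊗[k] (H ⊗[k] A) :=
  TensorProduct.tensorTensorTensorComm k H H A A
    (Coalgebra.comul (R := k) x ⊗ₜ[k] Coalgebra.comul (R := k) a)

/-- `A` is a left module over the Hopf structure `hH` via `act`. -/
structure IsLeftModule (hH : HopfStr k H) (act : H ⊗[k] A →ₗ[k] A) : Prop where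
  one_act : ∀ a : A, act (hH.one ⊗ₜ[k] a) = a
  mul_act : ∀ (x y : H) (a : A),
    act (hH.mul (x ⊗ₜ[k] y) ⊗ₜ[k] a) = act (x ⊗ₜ[k] act (y ⊗ₜ[k] a))

/-- `A` is a left module over `hH`-op via `act`, i.e. `(xy) ▶ a = y ▶ (x ▶ a)`. -/
structure IsLeftOpModule (hH : HopfStr k H) (act : H ⊗[k] A →ₗ[k] A) : Prop where
  one_act : ∀ a : A, act (hH.one ⊗ₜ[k] a) = a
  mul_act : ∀ (x y : H) (a : A),
    act (hH.mul (x ⊗ₜ[k] y) ⊗ₜ[k] a) = act (y ⊗ₜ[k] act (x ⊗ₜ[k] a))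

/-- The measuring conditions: `x ▶ (ab) = (x₍₁₎ ▶ a)(x₍₂₎ ▶ b)` and `x ▶ 1 = ε(x)1`. -/
structure IsModuleAlgebraLaw (hA : HopfStr k A) (act : H ⊗[k] A →ₗ[k] A) : Prop where
  act_mul : ∀ (x : H) (a b : A),
    act (x ⊗ₜ[k] hA.mul (a ⊗ₜ[k] b)) =
      hA.mul (TensorProduct.map act act
        (TensorProduct.tensorTensorTensorComm k H H A A
          (Coalgebra.comul (R := k) x ⊗ₜ[k] (a ⊗ₜ[k] b))))
  act_one : ∀ x : H, act (x ⊗ₜ[k] hA.one) = Coalgebra.counit (R := k) x • hA.one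

/-- `act` is a coalgebra map: `Δ(x ▶ a) = (x₍₁₎ ▶ a₍₁₎) ⊗ (x₍₂₎ ▶ a₍₂₎)`,
`ε(x ▶ a) = ε(x)ε(a)`. -/
structure IsCoalgebraLaw (act : H ⊗[k] A →ₗ[k] A) : Prop where
  comul_act : ∀ (x : H) (a : A),
    Coalgebra.comul (R := k) (act (x ⊗ₜ[k] a)) = TensorProduct.map act act (split x a)
  counit_act : ∀ (x : H) (a : A),
    Coalgebra.counit (R := k) (act (x ⊗ₜ[k] a)) =
      Coalgebra.counit (R := k) x * Coalgebra.counit (R := k) a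

/-- `(A, act)` is a left `hH`-module algebra. -/
structure IsLeftModuleAlgebra (hH : HopfStr k H) (hA : HopfStr k A)
    (act : H ⊗[k] A →ₗ[k] A) : Prop where
  toIsLeftModule : IsLeftModule hH act
  toLaw : IsModuleAlgebraLaw hA act

/-- `(A, act)` is a left `hH`-module coalgebra. -/
structure IsLeftModuleCoalgebra (hH : HopfStr k H) (act : H ⊗[k] A →ₗ[k] A) : Prop where
  toIsLeftModule : IsLeftModule hH act
  toCoalgLaw : IsCoalgebraLaw act

/-- `(A, act)` is a left `hH`-module bialgebra. -/
structure IsLeftModuleBialgebra (hH : HopfStr k H) (hA : HopfStr k A)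
    (act : H ⊗[k] A →ₗ[k] A) : Prop where
  toIsLeftModule : IsLeftModule hH act
  toLaw : IsModuleAlgebraLaw hA act
  toCoalgLaw : IsCoalgebraLaw act

/-- `(A, act)` is a left `hH`-op-module bialgebra. -/
structure IsLeftOpModuleBialgebra (hH : HopfStr k H) (hA : HopfStr k A)
    (act : H ⊗[k] A →ₗ[k] A) : Prop where
  toIsLeftOpModule : IsLeftOpModule hH act
  toLaw : IsModuleAlgebraLaw hA act
  toCoalgLaw : IsCoalgebraLaw act

/-- `H` is a right module over the Hopf structure `hA` via `ract : H ⊗ A → H`. -/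
structure IsRightModule (hA : HopfStr k A) (ract : H ⊗[k] A →ₗ[k] H) : Prop where
  act_one : ∀ x : H, ract (x ⊗ₜ[k] hA.one) = x
  act_mul : ∀ (x : H) (a b : A),
    ract (x ⊗ₜ[k] hA.mul (a ⊗ₜ[k] b)) = ract (ract (x ⊗ₜ[k] a) ⊗ₜ[k] b)

/-- `ract` is a coalgebra map `H ⊗ A → H`. -/
structure IsRightCoalgebraLaw (ract : H ⊗[k] A →ₗ[k] H) : Prop where
  comul_act : ∀ (x : H) (a : A),
    Coalgebra.comul (R := k) (ract (x ⊗ₜ[k] a)) = TensorProduct.map ract ract (split x a)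
  counit_act : ∀ (x : H) (a : A),
    Coalgebra.counit (R := k) (ract (x ⊗ₜ[k] a)) =
      Coalgebra.counit (R := k) x * Coalgebra.counit (R := k) a

/-- `(H, ract)` is a right `hA`-module bialgebra:  in addition to the module and coalgebra
conditions, `(xy) ◁ a = (x ◁ a₍₁₎)(y ◁ a₍₂₎)` and `1 ◁ a = ε(a)1`. -/
structure IsRightModuleBialgebra (hA : HopfStr k A) (hH : HopfStr k H)
    (ract : H ⊗[k] A →ₗ[k] H) : Prop where
  toIsRightModule : IsRightModule hA ract
  mul_ract : ∀ (x y : H) (a : A),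
    ract (hH.mul (x ⊗ₜ[k] y) ⊗ₜ[k] a) =
      hH.mul (TensorProduct.map ract ract
        (TensorProduct.tensorTensorTensorComm k H H A A
          ((x ⊗ₜ[k] y) ⊗ₜ[k] Coalgebra.comul (R := k) a)))
  one_ract : ∀ a : A, ract (hH.one ⊗ₜ[k] a) = Coalgebra.counit (R := k) a • hH.one
  toCoalgLaw : IsRightCoalgebraLaw ract

/-- `(A, H, tri, quad)` is a matched pair of Hopf algebras. -/
structure IsMatchedPair (hA : HopfStr k A) (hH : HopfStr k H)
    (tri : H ⊗[k] A →ₗ[k] A) (quad : H ⊗[k] A →ₗ[k] H) : Prop where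
  tri_module : IsLeftModule hH tri
  tri_coalg : IsCoalgebraLaw tri
  quad_module : IsRightModule hA quad
  quad_coalg : IsRightCoalgebraLaw quad
  mp1 : ∀ x : H, tri (x ⊗ₜ[k] hA.one) = Coalgebra.counit (R := k) x • hA.one
  mp1' : ∀ a : A, quad (hH.one ⊗ₜ[k] a) = Coalgebra.counit (R := k) a • hH.one
  mp2 : ∀ (x : H) (a b : A),
    tri (x ⊗ₜ[k] hA.mul (a ⊗ₜ[k] b)) =
      hA.mul (lTensor A tri (TensorProduct.assoc k A H A
        ((TensorProduct.map tri quad (split x a)) ⊗ₜ[k] b)))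
  mp3 : ∀ (x y : H) (a : A),
    quad (hH.mul (x ⊗ₜ[k] y) ⊗ₜ[k] a) =
      hH.mul (rTensor H quad ((TensorProduct.assoc k H A H).symm
        (x ⊗ₜ[k] TensorProduct.map tri quad (split y a))))
  mp4 : ∀ (x : H) (a : A),
    TensorProduct.map quad tri (split x a) =
      TensorProduct.comm k A H (TensorProduct.map tri quad (split x a))

variable (k) in
/-- `(a ⊗ (u₁ ⊗ u₂)) ⊗ y ↦ mA (a ⊗ u₁) ⊗ mH (u₂ ⊗ y)`: the standard way to assemble
a multiplication on `A ⊗ H` from a middle term `u ∈ A ⊗ H`. -/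
noncomputable def sandwich (mA : A ⊗[k] A →ₗ[k] A) (mH : H ⊗[k] H →ₗ[k] H) :
    (A ⊗[k] (A ⊗[k] H)) ⊗[k] H →ₗ[k] A ⊗[k] H :=
  TensorProduct.map mA mH
    ∘ₗ (TensorProduct.assoc k (A ⊗[k] A) H H).toLinearMap
    ∘ₗ rTensor H (TensorProduct.assoc k A A H).symm.toLinearMap

variable (k) in
/-- `(m ⊗ n) ⊗ p ↦ (m ⊗ p) ⊗ n`. -/
noncomputable def rightComm (M N P : Type u) [AddCommGroup M] [Module k M]
    [AddCommGroup N] [Module k N] [AddCommGroup P] [Module k P] :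
    (M ⊗[k] N) ⊗[k] P →ₗ[k] (M ⊗[k] P) ⊗[k] N :=
  (TensorProduct.assoc k M P N).symm.toLinearMap
    ∘ₗ lTensor M (TensorProduct.comm k N P).toLinearMap
    ∘ₗ (TensorProduct.assoc k M N P).toLinearMap

/-- `(x, b) ↦ (x₍₁₎ ▷ b₍₁₎) ⊗ (x₍₂₎ ◁ b₍₂₎)`. -/
noncomputable def matchedEl (tri : H ⊗[k] A →ₗ[k] A) (quad : H ⊗[k] A →ₗ[k] H)
    (x : H) (b : A) : A ⊗[k] H :=
  TensorProduct.map tri quad (split x b)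

/-- `(x, b) ↦ (x₍₁₎ ▷ b) ⊗ x₍₂₎`. -/
noncomputable def smashEl (tri : H ⊗[k] A →ₗ[k] A) (x : H) (b : A) : A ⊗[k] H :=
  rTensor H tri (rightComm k H H A (Coalgebra.comul (R := k) x ⊗ₜ[k] b))

/-- `(x, b) ↦ b₍₁₎ ⊗ (x ◁ b₍₂₎)`. -/
noncomputable def rsmashEl (ract : H ⊗[k] A →ₗ[k] H) (x : H) (b : A) : A ⊗[k] H :=
  lTensor A ract (TensorProduct.leftComm k H A A (x ⊗ₜ[k] Coalgebra.comul (R := k) b))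

end Actions

section Projections

open Coalgebra

variable {k}
variable {A B : Type u} [AddCommMonoid A] [Module k A] [AddCommMonoid B] [Module k B]

/-- The projection `a ⊗ b ↦ ε(b)a`. -/
noncomputable def proj₁ [Coalgebra k B] : A ⊗[k] B →ₗ[k] A :=
  (TensorProduct.rid k A).toLinearMap ∘ₗ lTensor A counit

/-- The projection `a ⊗ b ↦ ε(a)b`. -/
noncomputable def proj₂ [Coalgebra k A] : A ⊗[k] B →ₗ[k] B :=
  (TensorProduct.lid k B).toLinearMap ∘ₗ rTensor B counit

@[simp]
theorem proj₁_tmul [Coalgebra k B] (a : A) (b : B) :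
    proj₁ (a ⊗ₜ[k] b) = counit (R := k) b • a := by
  simp [proj₁]

@[simp]
theorem proj₂_tmul [Coalgebra k A] (a : A) (b : B) :
    proj₂ (a ⊗ₜ[k] b) = counit (R := k) a • b := by
  simp [proj₂]

end Projections

section CoalgebraPairs

open Coalgebra

variable {k}
variable {A B C : Type u}
  [AddCommMonoid A] [Module k A] [Coalgebra k A]
  [AddCommMonoid B] [Module k B] [Coalgebra k B]
  [AddCommMonoid C] [Module k C] [Coalgebra k C]

theorem map_comul_comul (c : C) :
    TensorProduct.map comul comul (comul (R := k) c) =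
      (TensorProduct.assoc k C C (C ⊗[k] C)).symm
        (lTensor C ((TensorProduct.assoc k C C C).toLinearMap ∘ₗ rTensor C comul)
          (lTensor C comul (comul (R := k) c))) := by
  rw [LinearEquiv.eq_symm_apply]
  have h1 : ∀ z : C ⊗[k] C, (TensorProduct.assoc k C C (C ⊗[k] C))
      (TensorProduct.map comul comul z) =
      lTensor C (lTensor C comul) (TensorProduct.assoc k C C C (rTensor C comul z)) := by
    intro z
    induction z with
    | zero => simp only [map_zero]
    | add _ _ h1 h2 => simp only [map_add, h1, h2]
    | tmul x y =>
      simp only [map_tmul, rTensor_tmul]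
      induction comul (R := k) x with
      | zero => simp only [map_zero, zero_tmul]
      | add _ _ h1 h2 => simp only [map_add, add_tmul, h1, h2]
      | tmul => simp
  rw [h1, coassoc_apply, ← lTensor_comp_apply, ← lTensor_comp_apply]
  congr 2
  rw [LinearMap.comp_assoc]
  exact (coassoc (R := k) (A := C)).symm

/-- The coalgebra map `c ↦ f c₍₁₎ ⊗ g c₍₂₎` determined by two coalgebra maps `f`, `g` whose images
commute in the sense that `g c₍₁₎ ⊗ f c₍₂₎ = g c₍₂₎ ⊗ f c₍₁₎`. -/
noncomputable def pairHom (f : C →ₗc[k] A) (g : C →ₗc[k] B)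
    (h : ∀ c : C, TensorProduct.map (g : C →ₗ[k] B) (f : C →ₗ[k] A) (comul c) =
      TensorProduct.comm k A B
        (TensorProduct.map (f : C →ₗ[k] A) (g : C →ₗ[k] B) (comul c))) :
    C →ₗc[k] A ⊗[k] B where
  toLinearMap := TensorProduct.map (f : C →ₗ[k] A) (g : C →ₗ[k] B) ∘ₗ comul
  counit_comp := by
    ext c
    have h1 : ∀ z : C ⊗[k] C,
        counit (R := k) (TensorProduct.map (f : C →ₗ[k] A) (g : C →ₗ[k] B) z) =
          counit (R := k) (TensorProduct.lid k C (rTensor C counit z)) := by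
      intro z
      induction z with
      | zero => simp only [map_zero]
      | add _ _ h1 h2 => simp only [map_add, h1, h2]
      | tmul x y => simp [mul_comm]
    simp [h1]
  map_comp_comul := by
    ext c
    have h1 : ∀ z : C ⊗[k] C,
        comul (R := k) (TensorProduct.map (f : C →ₗ[k] A) (g : C →ₗ[k] B) z) =
          TensorProduct.tensorTensorTensorComm k A A B B
            (TensorProduct.map (TensorProduct.map (f : C →ₗ[k] A) (f : C →ₗ[k] A))
              (TensorProduct.map (g : C →ₗ[k] B) (g : C →ₗ[k] B))
              (TensorProduct.map comul comul z)) := by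
      intro z
      induction z with
      | zero => simp only [map_zero]
      | add _ _ h1 h2 => simp only [map_add, h1, h2]
      | tmul x y =>
        simp only [map_tmul, TensorProduct.comul_tmul, CoalgHomClass.map_comp_comul_apply,
          CoalgHom.coe_toLinearMap]
        rfl
    have h2 : ∀ z : C ⊗[k] C,
        TensorProduct.map (TensorProduct.map (f : C →ₗ[k] A) (g : C →ₗ[k] B) ∘ₗ comul)
          (TensorProduct.map (f : C →ₗ[k] A) (g : C →ₗ[k] B) ∘ₗ comul) z =
        TensorProduct.map (TensorProduct.map (f : C →ₗ[k] A) (g : C →ₗ[k] B))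
          (TensorProduct.map (f : C →ₗ[k] A) (g : C →ₗ[k] B))
          (TensorProduct.map comul comul z) := by
      intro z
      rw [TensorProduct.map_comp]; rfl
    simp only [LinearMap.comp_apply, h1, h2, map_comul_comul]
    induction lTensor C comul (comul (R := k) c) with
    | zero => simp only [map_zero]
    | add _ _ h1 h2 => simp only [map_add, h1, h2]
    | tmul p w =>
      induction w with
      | zero => simp only [map_zero, tmul_zero]
      | add _ _ h1 h2 => simp only [map_add, tmul_add, h1, h2]
      | tmul q r =>
        let L : B ⊗[k] A →ₗ[k] (A ⊗[k] B) ⊗[k] (A ⊗[k] B) :=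
          TensorProduct.map (TensorProduct.mk k A B (f p)) ((TensorProduct.mk k A B).flip (g r))
        have e1 : ∀ z : C ⊗[k] C,
            TensorProduct.map (TensorProduct.map (f : C →ₗ[k] A) (g : C →ₗ[k] B))
              (TensorProduct.map (f : C →ₗ[k] A) (g : C →ₗ[k] B))
              ((TensorProduct.assoc k C C (C ⊗[k] C)).symm
                (p ⊗ₜ[k] TensorProduct.assoc k C C C (z ⊗ₜ[k] r))) =
            L (TensorProduct.map (g : C →ₗ[k] B) (f : C →ₗ[k] A) z) := by
          intro z
          induction z with
          | zero => simp only [map_zero, tmul_zero, zero_tmul]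
          | add _ _ h1 h2 => simp only [map_add, tmul_add, add_tmul, h1, h2]
          | tmul x y => simp [L]
        have e2 : ∀ z : C ⊗[k] C,
            TensorProduct.tensorTensorTensorComm k A A B B
              (TensorProduct.map (TensorProduct.map (f : C →ₗ[k] A) (f : C →ₗ[k] A))
              (TensorProduct.map (g : C →ₗ[k] B) (g : C →ₗ[k] B))
              ((TensorProduct.assoc k C C (C ⊗[k] C)).symm
                (p ⊗ₜ[k] TensorProduct.assoc k C C C (z ⊗ₜ[k] r)))) =
            L (TensorProduct.comm k A B
              (TensorProduct.map (f : C →ₗ[k] A) (g : C →ₗ[k] B) z)) := by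
          intro z
          induction z with
          | zero => simp only [map_zero, tmul_zero, zero_tmul]
          | add _ _ h1 h2 => simp only [map_add, tmul_add, add_tmul, h1, h2]
          | tmul x y => simp [L]
        simp only [lTensor_tmul, LinearMap.comp_apply, rTensor_tmul, LinearEquiv.coe_coe]
        rw [e1, e2, h]

theorem map_proj_comul (w : A ⊗[k] B) :
    TensorProduct.map proj₁ proj₂ (comul (R := k) w) = w := by
  induction w with
  | zero => simp only [map_zero]
  | add _ _ h1 h2 => simp only [map_add, h1, h2]
  | tmul a b =>
    have h : ∀ (s : A ⊗[k] A) (t : B ⊗[k] B),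
        TensorProduct.map proj₁ proj₂ (TensorProduct.tensorTensorTensorComm k A A B B
          (s ⊗ₜ[k] t)) = TensorProduct.rid k A (lTensor A counit s) ⊗ₜ[k]
            TensorProduct.lid k B (rTensor B counit t) := by
      intro s t
      induction s with
      | zero => simp only [map_zero, zero_tmul]
      | add _ _ h1 h2 => simp only [map_add, add_tmul, h1, h2]
      | tmul =>
        induction t with
        | zero => simp only [map_zero, tmul_zero]
        | add _ _ h1 h2 => simp only [map_add, tmul_add, h1, h2]
        | tmul => simp [smul_tmul, tmul_smul, smul_smul, mul_comm]
    refine (h _ _).trans ?_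
    simp

/-- A coalgebra map into `A ⊗ B` is determined by its two components. -/
theorem coalgHom_ext_proj {φ ψ : C →ₗc[k] A ⊗[k] B} (h₁ : ∀ c, proj₁ (φ c) = proj₁ (ψ c))
    (h₂ : ∀ c, proj₂ (φ c) = proj₂ (ψ c)) : φ = ψ := by
  have key : ∀ (χ : C →ₗc[k] A ⊗[k] B) (c : C), χ c =
      TensorProduct.map (proj₁ ∘ₗ (χ : C →ₗ[k] A ⊗[k] B)) (proj₂ ∘ₗ (χ : C →ₗ[k] A ⊗[k] B))
        (comul c) := by
    intro χ c
    rw [TensorProduct.map_comp, LinearMap.comp_apply, CoalgHomClass.map_comp_comul_apply,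
      map_proj_comul]
  have e₁ : proj₁ ∘ₗ (φ : C →ₗ[k] A ⊗[k] B) = proj₁ ∘ₗ (ψ : C →ₗ[k] A ⊗[k] B) :=
    LinearMap.ext h₁
  have e₂ : proj₂ ∘ₗ (φ : C →ₗ[k] A ⊗[k] B) = proj₂ ∘ₗ (ψ : C →ₗ[k] A ⊗[k] B) :=
    LinearMap.ext h₂
  ext c
  rw [key φ, key ψ, e₁, e₂]

theorem proj₁_pairHom (f : C →ₗc[k] A) (g : C →ₗc[k] B) (h) (c : C) :
    proj₁ (pairHom f g h c) = f c := by
  have h1 : ∀ z : C ⊗[k] C,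
      proj₁ (TensorProduct.map (f : C →ₗ[k] A) (g : C →ₗ[k] B) z) =
        f (TensorProduct.rid k C (lTensor C counit z)) := by
    intro z
    induction z with
    | zero => simp only [map_zero]
    | add _ _ h1 h2 => simp only [map_add, h1, h2]
    | tmul x y => simp
  refine (h1 _).trans ?_
  simp

theorem proj₂_pairHom (f : C →ₗc[k] A) (g : C →ₗc[k] B) (h) (c : C) :
    proj₂ (pairHom f g h c) = g c := by
  have h1 : ∀ z : C ⊗[k] C,
      proj₂ (TensorProduct.map (f : C →ₗ[k] A) (g : C →ₗ[k] B) z) =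
        g (TensorProduct.lid k C (rTensor C counit z)) := by
    intro z
    induction z with
    | zero => simp only [map_zero]
    | add _ _ h1 h2 => simp only [map_add, h1, h2]
    | tmul x y => simp
  refine (h1 _).trans ?_
  simp

end CoalgebraPairs

section HopfStrLemmas

open Coalgebra

variable {k}
variable {V : Type u} [AddCommGroup V] [Module k V] [Coalgebra k V]

/-- The multiplication of a Hopf structure as a coalgebra map. -/
noncomputable def HopfStr.mulHom (hs : HopfStr k V) : V ⊗[k] V →ₗc[k] V where
  toLinearMap := hs.mul
  counit_comp := TensorProduct.ext' fun a b => by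
    simp [hs.counit_mul, mul_comm]
  map_comp_comul := TensorProduct.ext' fun a b => (hs.comul_mul a b).symm

theorem HopfStr.sum_antipode_mul (hs : HopfStr k V) {x : V} {ι : Type*} (r : Repr k x ι) :
    ∑ i ∈ r.index, hs.mul (hs.antipode (r.left i) ⊗ₜ[k] r.right i) =
      counit (R := k) x • hs.one := by
  have h := LinearMap.congr_fun hs.antipode_left x
  simpa [← r.eq] using h

theorem HopfStr.sum_mul_antipode (hs : HopfStr k V) {x : V} {ι : Type*} (r : Repr k x ι) :
    ∑ i ∈ r.index, hs.mul (r.left i ⊗ₜ[k] hs.antipode (r.right i)) =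
      counit (R := k) x • hs.one := by
  have h := LinearMap.congr_fun hs.antipode_right x
  simpa [← r.eq] using h

theorem sum_tmul_tmul_comm {W : Type u} [AddCommGroup W] [Module k W]
    (hV : IsCocomm k V) (F : V ⊗[k] V →ₗ[k] W) {x : V} {ι : Type*} (r : Repr k x ι) :
    ∑ i ∈ r.index, F (r.left i ⊗ₜ[k] r.right i) =
      ∑ i ∈ r.index, F (r.right i ⊗ₜ[k] r.left i) := by
  have h := LinearMap.congr_fun hV x
  simp only [LinearMap.comp_apply, ← r.eq, map_sum, LinearEquiv.coe_coe, comm_tmul] at h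
  rw [← map_sum, ← map_sum, h]

/-- `x₍₁₎ S(x₍₂₎) ⊗ x₍₃₎ = 1 ⊗ x`. -/
theorem HopfStr.sum_mul_antipode_tmul (hs : HopfStr k V) {x : V} {ι : Type*} {κ : ι → Type*}
    (r : Repr k x ι) (s : (i : ι) → Repr k (r.right i) (κ i)) :
    ∑ i ∈ r.index, ∑ j ∈ (s i).index,
      hs.mul (r.left i ⊗ₜ[k] hs.antipode ((s i).left j)) ⊗ₜ[k] (s i).right j =
      hs.one ⊗ₜ[k] x := by
  have h := congrArg (rTensor V (hs.mul ∘ₗ lTensor V hs.antipode) ∘ₗ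
    (TensorProduct.assoc k V V V).symm.toLinearMap)
      (sum_tmul_tmul_eq r (fun i => Repr.arbitrary k (r.left i)) s)
  simp only [map_sum, LinearMap.comp_apply, LinearEquiv.coe_coe, assoc_symm_tmul, rTensor_tmul,
    lTensor_tmul] at h
  rw [← h]
  simp only [← sum_tmul, hs.sum_mul_antipode, smul_tmul]
  rw [← tmul_sum, sum_counit_smul]

/-- `x₍₁₎ ⊗ S(x₍₂₎) x₍₃₎ = x ⊗ 1`. -/
theorem HopfStr.sum_tmul_antipode_mul (hs : HopfStr k V) {x : V} {ι : Type*} {κ : ι → Type*}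
    (r : Repr k x ι) (s : (i : ι) → Repr k (r.right i) (κ i)) :
    ∑ i ∈ r.index, ∑ j ∈ (s i).index,
      r.left i ⊗ₜ[k] hs.mul (hs.antipode ((s i).left j) ⊗ₜ[k] (s i).right j) =
      x ⊗ₜ[k] hs.one := by
  simp only [← tmul_sum, hs.sum_antipode_mul, ← smul_tmul]
  have h := congrArg (TensorProduct.rid k V) (sum_tmul_counit_eq r)
  simp only [map_sum, rid_tmul, one_smul] at h
  rw [← sum_tmul, h]

theorem comul_tmul_repr {A B : Type u} [AddCommGroup A] [Module k A] [Coalgebra k A]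
    [AddCommGroup B] [Module k B] [Coalgebra k B] {a : A} {b : B} {ι κ : Type*}
    (r : Repr k a ι) (s : Repr k b κ) :
    comul (R := k) (a ⊗ₜ[k] b) = ∑ i ∈ r.index, ∑ j ∈ s.index,
      (r.left i ⊗ₜ[k] s.left j) ⊗ₜ[k] (r.right i ⊗ₜ[k] s.right j) := by
  rw [TensorProduct.comul_tmul, ← r.eq, ← s.eq]
  simp only [sum_tmul, tmul_sum, map_sum]
  rw [Finset.sum_comm]
  rfl

end HopfStrLemmas

section Constructions

open Coalgebra

variable {k}
variable {V A B : Type u} [AddCommGroup V] [Module k V] [Coalgebra k V]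
  [AddCommGroup A] [Module k A] [Coalgebra k A]
  [AddCommGroup B] [Module k B] [Coalgebra k B]

/-- The opposite of a Hopf structure on a cocommutative coalgebra. -/
noncomputable def HopfStr.op (hs : HopfStr k V) (hV : IsCocomm k V) : HopfStr k V where
  mul := hs.mul ∘ₗ (TensorProduct.comm k V V).toLinearMap
  one := hs.one
  mul_assoc a b c := by simp [hs.mul_assoc]
  one_mul a := by simp [hs.mul_one]
  mul_one a := by simp [hs.one_mul]
  comul_mul a b := by
    simp only [LinearMap.comp_apply, LinearEquiv.coe_coe, comm_tmul, hs.comul_mul]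
    induction comul (R := k) a with
    | zero => simp only [map_zero, zero_tmul, tmul_zero]
    | add _ _ h1 h2 => simp only [map_add, add_tmul, tmul_add, h1, h2]
    | tmul =>
      induction comul (R := k) b with
      | zero => simp only [map_zero, zero_tmul, tmul_zero]
      | add _ _ h1 h2 => simp only [map_add, add_tmul, tmul_add, h1, h2]
      | tmul => simp
  counit_mul a b := by simp [hs.counit_mul, mul_comm]
  comul_one := hs.comul_one
  counit_one := hs.counit_one
  antipode := hs.antipode
  antipode_left := by
    ext x
    have r := Repr.arbitrary k x
    have h := sum_tmul_tmul_comm hV (hs.mul ∘ₗ lTensor V hs.antipode) r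
    simp only [LinearMap.comp_apply, lTensor_tmul, hs.sum_mul_antipode] at h
    simp [← r.eq, ← h]
  antipode_right := by
    ext x
    have r := Repr.arbitrary k x
    have h := sum_tmul_tmul_comm hV (hs.mul ∘ₗ rTensor V hs.antipode) r
    simp only [LinearMap.comp_apply, rTensor_tmul, hs.sum_antipode_mul] at h
    simp [← r.eq, ← h]

theorem comul_one_tmul_one (hA : HopfStr k A) (hB : HopfStr k B) :
    comul (R := k) (hA.one ⊗ₜ[k] hB.one) =
      (hA.one ⊗ₜ[k] hB.one) ⊗ₜ[k] (hA.one ⊗ₜ[k] hB.one) := by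
  rw [TensorProduct.comul_tmul, hA.comul_one, hB.comul_one]
  rfl

theorem counit_one_tmul_one (hA : HopfStr k A) (hB : HopfStr k B) :
    counit (R := k) (hA.one ⊗ₜ[k] hB.one) = 1 := by
  simp [hA.counit_one, hB.counit_one]

/-- The componentwise multiplication `(a ⊗ x)(b ⊗ y) = ab ⊗ xy` of `A ⊗ B`. -/
noncomputable def HopfStr.tensorMul (hA : HopfStr k A) (hB : HopfStr k B) :
    (A ⊗[k] B) ⊗[k] (A ⊗[k] B) →ₗ[k] A ⊗[k] B :=
  TensorProduct.map hA.mul hB.mul ∘ₗ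
    (TensorProduct.tensorTensorTensorComm k A B A B).toLinearMap

@[simp]
theorem HopfStr.tensorMul_tmul (hA : HopfStr k A) (hB : HopfStr k B) (a b : A) (x y : B) :
    hA.tensorMul hB ((a ⊗ₜ[k] x) ⊗ₜ[k] (b ⊗ₜ[k] y)) =
      hA.mul (a ⊗ₜ[k] b) ⊗ₜ[k] hB.mul (x ⊗ₜ[k] y) := rfl

theorem HopfStr.comul_tensorMul (hA : HopfStr k A) (hB : HopfStr k B) (u v : A ⊗[k] B) :
    comul (R := k) (hA.tensorMul hB (u ⊗ₜ[k] v)) =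
      TensorProduct.map (hA.tensorMul hB) (hA.tensorMul hB)
        (TensorProduct.tensorTensorTensorComm k (A ⊗[k] B) (A ⊗[k] B) (A ⊗[k] B) (A ⊗[k] B)
          (comul (R := k) u ⊗ₜ[k] comul (R := k) v)) := by
  induction u with
  | zero => simp only [map_zero, zero_tmul]
  | add _ _ h1 h2 => simp only [map_add, add_tmul, h1, h2]
  | tmul a x =>
    induction v with
    | zero => simp only [map_zero, tmul_zero]
    | add _ _ h1 h2 => simp only [map_add, tmul_add, h1, h2]
    | tmul b y =>
      rw [tensorMul_tmul, TensorProduct.comul_tmul, TensorProduct.comul_tmul,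
        TensorProduct.comul_tmul, hA.comul_mul, hB.comul_mul]
      induction comul (R := k) a with
      | zero => simp only [map_zero, zero_tmul]
      | add _ _ h1 h2 => simp only [map_add, add_tmul, h1, h2]
      | tmul =>
      induction comul (R := k) b with
      | zero => simp only [map_zero, zero_tmul, tmul_zero]
      | add _ _ h1 h2 => simp only [map_add, add_tmul, tmul_add, h1, h2]
      | tmul =>
      induction comul (R := k) x with
      | zero => simp only [map_zero, zero_tmul, tmul_zero]
      | add _ _ h1 h2 => simp only [map_add, add_tmul, tmul_add, h1, h2]
      | tmul =>
      induction comul (R := k) y with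
      | zero => simp only [map_zero, tmul_zero]
      | add _ _ h1 h2 => simp only [map_add, tmul_add, h1, h2]
      | tmul => rfl

/-- The tensor product of two Hopf structures. -/
noncomputable def HopfStr.tensor (hA : HopfStr k A) (hB : HopfStr k B) :
    HopfStr k (A ⊗[k] B) where
  mul := hA.tensorMul hB
  one := hA.one ⊗ₜ[k] hB.one
  mul_assoc u v w := by
    induction u with
    | zero => simp only [map_zero, zero_tmul]
    | add _ _ h1 h2 => simp only [map_add, add_tmul, h1, h2]
    | tmul =>
    induction v with
    | zero => simp only [map_zero, zero_tmul, tmul_zero]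
    | add _ _ h1 h2 => simp only [map_add, add_tmul, tmul_add, h1, h2]
    | tmul =>
    induction w with
    | zero => simp only [map_zero, tmul_zero]
    | add _ _ h1 h2 => simp only [map_add, tmul_add, h1, h2]
    | tmul => simp [hA.mul_assoc, hB.mul_assoc]
  one_mul u := by
    induction u with
    | zero => simp only [map_zero, tmul_zero]
    | add _ _ h1 h2 => simp only [map_add, tmul_add, h1, h2]
    | tmul => simp [hA.one_mul, hB.one_mul]
  mul_one u := by
    induction u with
    | zero => simp only [map_zero, zero_tmul]
    | add _ _ h1 h2 => simp only [map_add, add_tmul, h1, h2]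
    | tmul => simp [hA.mul_one, hB.mul_one]
  comul_mul := hA.comul_tensorMul hB
  counit_mul u v := by
    induction u with
    | zero => simp only [map_zero, zero_tmul, zero_mul]
    | add _ _ h1 h2 => simp only [map_add, add_tmul, add_mul, h1, h2]
    | tmul =>
    induction v with
    | zero => simp only [map_zero, tmul_zero, mul_zero]
    | add _ _ h1 h2 => simp only [map_add, tmul_add, mul_add, h1, h2]
    | tmul =>
      simp only [tensorMul_tmul, TensorProduct.counit_tmul, hA.counit_mul, hB.counit_mul,
        smul_eq_mul]
      ring
  comul_one := comul_one_tmul_one hA hB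
  counit_one := counit_one_tmul_one hA hB
  antipode := TensorProduct.map hA.antipode hB.antipode
  antipode_left := TensorProduct.ext' fun a x => by
    have r := Repr.arbitrary k a
    have s := Repr.arbitrary k x
    simp only [LinearMap.comp_apply, comul_tmul_repr r s, map_sum, rTensor_tmul, map_tmul,
      tensorMul_tmul, ← tmul_sum, sum_antipode_mul, TensorProduct.counit_tmul,
      toSpanSingleton_apply, tmul_smul, smul_eq_mul]
    rw [← Finset.smul_sum, ← sum_tmul, sum_antipode_mul, ← smul_tmul', smul_smul]
  antipode_right := TensorProduct.ext' fun a x => by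
    have r := Repr.arbitrary k a
    have s := Repr.arbitrary k x
    simp only [LinearMap.comp_apply, comul_tmul_repr r s, map_sum, lTensor_tmul, map_tmul,
      tensorMul_tmul, ← tmul_sum, sum_mul_antipode, TensorProduct.counit_tmul,
      toSpanSingleton_apply, tmul_smul, smul_eq_mul]
    rw [← Finset.smul_sum, ← sum_tmul, sum_mul_antipode, ← smul_tmul', smul_smul]

end Constructions

section CoalgHoms

variable (M N P : Type u)
  [AddCommMonoid M] [Module k M] [Coalgebra k M]
  [AddCommMonoid N] [Module k N] [Coalgebra k N]
  [AddCommMonoid P] [Module k P] [Coalgebra k P]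

/-- The associator as a coalgebra map. -/
noncomputable def assocHom : (M ⊗[k] N) ⊗[k] P →ₗc[k] M ⊗[k] (N ⊗[k] P) :=
  (Coalgebra.TensorProduct.assoc k k M N P).toCoalgHom

/-- The inverse associator as a coalgebra map. -/
noncomputable def assocSymmHom : M ⊗[k] (N ⊗[k] P) →ₗc[k] (M ⊗[k] N) ⊗[k] P :=
  (Coalgebra.TensorProduct.assoc k k M N P).symm.toCoalgHom

variable {k}

/-- `f ⊗ id` as a coalgebra map. -/
noncomputable def rTensorHom (f : M →ₗc[k] N) : M ⊗[k] P →ₗc[k] N ⊗[k] P :=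
  Coalgebra.TensorProduct.map f (CoalgHom.id k P)

/-- `id ⊗ f` as a coalgebra map. -/
noncomputable def lTensorHom (f : M →ₗc[k] N) : P ⊗[k] M →ₗc[k] P ⊗[k] N :=
  Coalgebra.TensorProduct.map (CoalgHom.id k P) f

variable {M N P}

@[simp]
theorem assocHom_tmul (x : M) (y : N) (z : P) :
    assocHom k M N P ((x ⊗ₜ[k] y) ⊗ₜ[k] z) = x ⊗ₜ[k] (y ⊗ₜ[k] z) := rfl

@[simp]
theorem assocSymmHom_tmul (x : M) (y : N) (z : P) :
    assocSymmHom k M N P (x ⊗ₜ[k] (y ⊗ₜ[k] z)) = (x ⊗ₜ[k] y) ⊗ₜ[k] z := rfl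

@[simp]
theorem rTensorHom_tmul (f : M →ₗc[k] N) (x : M) (y : P) :
    rTensorHom M N P f (x ⊗ₜ[k] y) = f x ⊗ₜ[k] y := rfl

@[simp]
theorem lTensorHom_tmul (f : M →ₗc[k] N) (x : M) (y : P) :
    lTensorHom M N P f (y ⊗ₜ[k] x) = y ⊗ₜ[k] f x := rfl

end CoalgHoms

section Bicrossed

open Coalgebra

variable {k}
variable {A H : Type u}
  [AddCommGroup A] [Module k A] [Coalgebra k A]
  [AddCommGroup H] [Module k H] [Coalgebra k H]
  {hA : HopfStr k A} {hH : HopfStr k H}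
  {tri : H ⊗[k] A →ₗ[k] A} {quad : H ⊗[k] A →ₗ[k] H}

/-- A left coalgebra action as a coalgebra map. -/
noncomputable def IsCoalgebraLaw.toCoalgHom (h : IsCoalgebraLaw tri) : H ⊗[k] A →ₗc[k] A where
  toLinearMap := tri
  counit_comp := TensorProduct.ext' fun a b => by simp [h.counit_act, mul_comm]
  map_comp_comul := TensorProduct.ext' fun a b => (h.comul_act a b).symm

/-- A right coalgebra action as a coalgebra map. -/
noncomputable def IsRightCoalgebraLaw.toCoalgHom (h : IsRightCoalgebraLaw quad) :
    H ⊗[k] A →ₗc[k] H where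
  toLinearMap := quad
  counit_comp := TensorProduct.ext' fun a b => by simp [h.counit_act, mul_comm]
  map_comp_comul := TensorProduct.ext' fun a b => (h.comul_act a b).symm

variable (hmp : IsMatchedPair hA hH tri quad)

/-- The coalgebra map `x ⊗ a ↦ (x₍₁₎ ▷ a₍₁₎) ⊗ (x₍₂₎ ◁ a₍₂₎)` of a matched pair. -/
noncomputable def IsMatchedPair.exchange : H ⊗[k] A →ₗc[k] A ⊗[k] H :=
  pairHom hmp.tri_coalg.toCoalgHom hmp.quad_coalg.toCoalgHom fun z => by
    induction z with
    | zero => simp only [map_zero]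
    | add _ _ h1 h2 => simp only [map_add, h1, h2]
    | tmul x a => exact hmp.mp4 x a

theorem IsMatchedPair.exchange_tmul (x : H) (a : A) :
    hmp.exchange (x ⊗ₜ[k] a) = matchedEl tri quad x a := rfl

theorem IsMatchedPair.proj₁_exchange (z : H ⊗[k] A) : proj₁ (hmp.exchange z) = tri z :=
  proj₁_pairHom _ _ _ z

theorem IsMatchedPair.proj₂_exchange (z : H ⊗[k] A) : proj₂ (hmp.exchange z) = quad z :=
  proj₂_pairHom _ _ _ z

/-- `a ⊗ (b ⊗ y) ↦ ab ⊗ y`. -/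
noncomputable def leftMul (hA : HopfStr k A) : A ⊗[k] (A ⊗[k] H) →ₗc[k] A ⊗[k] H :=
  (rTensorHom (A ⊗[k] A) A H hA.mulHom).comp (assocSymmHom k A A H)

/-- `(b ⊗ x) ⊗ y ↦ b ⊗ xy`. -/
noncomputable def rightMul (hH : HopfStr k H) : (A ⊗[k] H) ⊗[k] H →ₗc[k] A ⊗[k] H :=
  (lTensorHom (H ⊗[k] H) H A hH.mulHom).comp (assocHom k A H H)

@[simp]
theorem leftMul_tmul (a b : A) (y : H) :
    leftMul hA (a ⊗ₜ[k] (b ⊗ₜ[k] y)) = hA.mul (a ⊗ₜ[k] b) ⊗ₜ[k] y := rfl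

@[simp]
theorem rightMul_tmul (b : A) (x y : H) :
    rightMul hH ((b ⊗ₜ[k] x) ⊗ₜ[k] y) = b ⊗ₜ[k] hH.mul (x ⊗ₜ[k] y) := rfl

/-- `x ⊗ (b ⊗ y) ↦ (x₍₁₎ ▷ b₍₁₎) ⊗ (x₍₂₎ ◁ b₍₂₎)y`. -/
noncomputable def IsMatchedPair.leftAct : H ⊗[k] (A ⊗[k] H) →ₗc[k] A ⊗[k] H :=
  ((rightMul hH).comp (rTensorHom (H ⊗[k] A) (A ⊗[k] H) H hmp.exchange)).comp
    (assocSymmHom k H A H)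

theorem IsMatchedPair.leftAct_tmul (x : H) (b : A) (y : H) :
    hmp.leftAct (x ⊗ₜ[k] (b ⊗ₜ[k] y)) = rightMul hH (hmp.exchange (x ⊗ₜ[k] b) ⊗ₜ[k] y) := rfl

/-- The bicrossed product multiplication. -/
noncomputable def IsMatchedPair.bicrossedMul :
    (A ⊗[k] H) ⊗[k] (A ⊗[k] H) →ₗc[k] A ⊗[k] H :=
  ((leftMul hA).comp (lTensorHom (H ⊗[k] (A ⊗[k] H)) (A ⊗[k] H) A hmp.leftAct)).comp
    (assocHom k A H (A ⊗[k] H))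

theorem IsMatchedPair.bicrossedMul_tmul (a : A) (x : H) (w : A ⊗[k] H) :
    hmp.bicrossedMul ((a ⊗ₜ[k] x) ⊗ₜ[k] w) =
      leftMul hA (a ⊗ₜ[k] hmp.leftAct (x ⊗ₜ[k] w)) := rfl

theorem proj₁_leftMul (a : A) (w : A ⊗[k] H) :
    proj₁ (leftMul hA (a ⊗ₜ[k] w)) = hA.mul (a ⊗ₜ[k] proj₁ w) := by
  induction w with
  | zero => simp only [map_zero, tmul_zero]
  | add _ _ h1 h2 => simp only [map_add, tmul_add, h1, h2]
  | tmul => simp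

theorem proj₂_leftMul (a : A) (w : A ⊗[k] H) :
    proj₂ (leftMul hA (a ⊗ₜ[k] w)) = counit (R := k) a • proj₂ w := by
  induction w with
  | zero => simp only [map_zero, tmul_zero, smul_zero]
  | add _ _ h1 h2 => simp only [map_add, tmul_add, smul_add, h1, h2]
  | tmul => simp [hA.counit_mul, smul_smul]

theorem proj₁_rightMul (w : A ⊗[k] H) (y : H) :
    proj₁ (rightMul hH (w ⊗ₜ[k] y)) = counit (R := k) y • proj₁ w := by
  induction w with
  | zero => simp only [map_zero, zero_tmul, smul_zero]
  | add _ _ h1 h2 => simp only [map_add, add_tmul, smul_add, h1, h2]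
  | tmul => simp [hH.counit_mul, smul_smul, mul_comm]

theorem proj₂_rightMul (w : A ⊗[k] H) (y : H) :
    proj₂ (rightMul hH (w ⊗ₜ[k] y)) = hH.mul (proj₂ w ⊗ₜ[k] y) := by
  induction w with
  | zero => simp only [map_zero, zero_tmul]
  | add _ _ h1 h2 => simp only [map_add, add_tmul, h1, h2]
  | tmul => simp [← smul_tmul']

/-- `x · bc = (x₍₁₎ ▷ b₍₁₎) ((x₍₂₎ ◁ b₍₂₎) · c)`. -/
theorem IsMatchedPair.exchange_mul_right (x : H) (b c : A) :
    hmp.exchange (x ⊗ₜ[k] hA.mul (b ⊗ₜ[k] c)) =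
      leftMul hA (lTensorHom (H ⊗[k] A) (A ⊗[k] H) A hmp.exchange
        (assocHom k A H A (hmp.exchange (x ⊗ₜ[k] b) ⊗ₜ[k] c))) := by
  let φ : H ⊗[k] (A ⊗[k] A) →ₗc[k] A ⊗[k] H :=
    hmp.exchange.comp (lTensorHom (A ⊗[k] A) A H hA.mulHom)
  let ψ : H ⊗[k] (A ⊗[k] A) →ₗc[k] A ⊗[k] H :=
    ((leftMul hA).comp (lTensorHom (H ⊗[k] A) (A ⊗[k] H) A hmp.exchange)).comp
      (((assocHom k A H A).comp (rTensorHom (H ⊗[k] A) (A ⊗[k] H) A hmp.exchange)).comp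
        (assocSymmHom k H A A))
  have h1 : ∀ (w : A ⊗[k] H) (c : A),
      proj₁ (leftMul hA (lTensorHom (H ⊗[k] A) (A ⊗[k] H) A hmp.exchange
        (assocHom k A H A (w ⊗ₜ[k] c)))) =
        hA.mul (lTensor A tri (TensorProduct.assoc k A H A (w ⊗ₜ[k] c))) := by
    intro w c
    induction w with
    | zero => simp only [map_zero, zero_tmul]
    | add _ _ h1 h2 => simp only [map_add, add_tmul, h1, h2]
    | tmul => simp [proj₁_leftMul, proj₁_exchange]
  have h2 : ∀ (w : A ⊗[k] H) (c : A),
      proj₂ (leftMul hA (lTensorHom (H ⊗[k] A) (A ⊗[k] H) A hmp.exchange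
        (assocHom k A H A (w ⊗ₜ[k] c)))) =
        quad (proj₂ w ⊗ₜ[k] c) := by
    intro w c
    induction w with
    | zero => simp only [map_zero, zero_tmul]
    | add _ _ h1 h2 => simp only [map_add, add_tmul, h1, h2]
    | tmul => simp [proj₂_leftMul, proj₂_exchange, ← smul_tmul']
  suffices φ = ψ from DFunLike.congr_fun this (x ⊗ₜ[k] (b ⊗ₜ[k] c))
  refine coalgHom_ext_proj (fun z => ?_) fun z => ?_
  · refine LinearMap.congr_fun (f := proj₁ ∘ₗ (φ : H ⊗[k] (A ⊗[k] A) →ₗ[k] A ⊗[k] H))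
      (g := proj₁ ∘ₗ (ψ : H ⊗[k] (A ⊗[k] A) →ₗ[k] A ⊗[k] H))
      (TensorProduct.ext_threefold' fun x b c => ?_) z
    refine (hmp.proj₁_exchange _).trans ((hmp.mp2 x b c).trans (h1 _ _).symm)
  · refine LinearMap.congr_fun (f := proj₂ ∘ₗ (φ : H ⊗[k] (A ⊗[k] A) →ₗ[k] A ⊗[k] H))
      (g := proj₂ ∘ₗ (ψ : H ⊗[k] (A ⊗[k] A) →ₗ[k] A ⊗[k] H))
      (TensorProduct.ext_threefold' fun x b c => ?_) z
    refine (hmp.proj₂_exchange _).trans (.trans ?_ (h2 (hmp.exchange (x ⊗ₜ[k] b)) c).symm)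
    rw [proj₂_exchange]
    exact hmp.quad_module.act_mul x b c

/-- `xy · b = (x · (y₍₁₎ ▷ b₍₁₎)) (y₍₂₎ ◁ b₍₂₎)`. -/
theorem IsMatchedPair.exchange_mul_left (x y : H) (b : A) :
    hmp.exchange (hH.mul (x ⊗ₜ[k] y) ⊗ₜ[k] b) =
      rightMul hH (rTensorHom (H ⊗[k] A) (A ⊗[k] H) H hmp.exchange
        (assocSymmHom k H A H (x ⊗ₜ[k] hmp.exchange (y ⊗ₜ[k] b)))) := by
  let φ : (H ⊗[k] H) ⊗[k] A →ₗc[k] A ⊗[k] H :=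
    hmp.exchange.comp (rTensorHom (H ⊗[k] H) H A hH.mulHom)
  let ψ : (H ⊗[k] H) ⊗[k] A →ₗc[k] A ⊗[k] H :=
    ((rightMul hH).comp (rTensorHom (H ⊗[k] A) (A ⊗[k] H) H hmp.exchange)).comp
      (((assocSymmHom k H A H).comp (lTensorHom (H ⊗[k] A) (A ⊗[k] H) H hmp.exchange)).comp
        (assocHom k H H A))
  have h1 : ∀ (x : H) (w : A ⊗[k] H),
      proj₁ (rightMul hH (rTensorHom (H ⊗[k] A) (A ⊗[k] H) H hmp.exchange
        (assocSymmHom k H A H (x ⊗ₜ[k] w)))) =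
        tri (x ⊗ₜ[k] proj₁ w) := by
    intro x w
    induction w with
    | zero => simp only [map_zero, tmul_zero]
    | add _ _ h1 h2 => simp only [map_add, tmul_add, h1, h2]
    | tmul => simp [proj₁_rightMul, proj₁_exchange]
  have h2 : ∀ (x : H) (w : A ⊗[k] H),
      proj₂ (rightMul hH (rTensorHom (H ⊗[k] A) (A ⊗[k] H) H hmp.exchange
        (assocSymmHom k H A H (x ⊗ₜ[k] w)))) =
        hH.mul (rTensor H quad ((TensorProduct.assoc k H A H).symm (x ⊗ₜ[k] w))) := by
    intro x w
    induction w with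
    | zero => simp only [map_zero, tmul_zero]
    | add _ _ h1 h2 => simp only [map_add, tmul_add, h1, h2]
    | tmul => simp [proj₂_rightMul, proj₂_exchange]
  suffices φ = ψ from DFunLike.congr_fun this ((x ⊗ₜ[k] y) ⊗ₜ[k] b)
  refine coalgHom_ext_proj (fun z => ?_) fun z => ?_
  · refine LinearMap.congr_fun (f := proj₁ ∘ₗ (φ : (H ⊗[k] H) ⊗[k] A →ₗ[k] A ⊗[k] H))
      (g := proj₁ ∘ₗ (ψ : (H ⊗[k] H) ⊗[k] A →ₗ[k] A ⊗[k] H))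
      (TensorProduct.ext_threefold fun x y b => ?_) z
    refine (hmp.proj₁_exchange _).trans (.trans ?_ (h1 x (hmp.exchange (y ⊗ₜ[k] b))).symm)
    rw [proj₁_exchange]
    exact hmp.tri_module.mul_act x y b
  · refine LinearMap.congr_fun (f := proj₂ ∘ₗ (φ : (H ⊗[k] H) ⊗[k] A →ₗ[k] A ⊗[k] H))
      (g := proj₂ ∘ₗ (ψ : (H ⊗[k] H) ⊗[k] A →ₗ[k] A ⊗[k] H))
      (TensorProduct.ext_threefold fun x y b => ?_) z
    exact (hmp.proj₂_exchange _).trans ((hmp.mp3 x y b).trans (h2 _ _).symm)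

theorem leftMul_leftMul (a b : A) (w : A ⊗[k] H) :
    leftMul hA (a ⊗ₜ[k] leftMul hA (b ⊗ₜ[k] w)) =
      leftMul hA (hA.mul (a ⊗ₜ[k] b) ⊗ₜ[k] w) := by
  induction w with
  | zero => simp only [map_zero, tmul_zero]
  | add _ _ h1 h2 => simp only [map_add, tmul_add, h1, h2]
  | tmul => simp [hA.mul_assoc]

theorem rightMul_rightMul (w : A ⊗[k] H) (x y : H) :
    rightMul hH (rightMul hH (w ⊗ₜ[k] x) ⊗ₜ[k] y) =
      rightMul hH (w ⊗ₜ[k] hH.mul (x ⊗ₜ[k] y)) := by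
  induction w with
  | zero => simp only [map_zero, zero_tmul]
  | add _ _ h1 h2 => simp only [map_add, add_tmul, h1, h2]
  | tmul => simp [hH.mul_assoc]

theorem leftMul_rightMul (a : A) (w : A ⊗[k] H) (y : H) :
    leftMul hA (a ⊗ₜ[k] rightMul hH (w ⊗ₜ[k] y)) =
      rightMul hH (leftMul hA (a ⊗ₜ[k] w) ⊗ₜ[k] y) := by
  induction w with
  | zero => simp only [map_zero, zero_tmul, tmul_zero]
  | add _ _ h1 h2 => simp only [map_add, add_tmul, tmul_add, h1, h2]
  | tmul => simp

theorem IsMatchedPair.leftAct_rightMul (x : H) (w : A ⊗[k] H) (y : H) :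
    hmp.leftAct (x ⊗ₜ[k] rightMul hH (w ⊗ₜ[k] y)) =
      rightMul hH (hmp.leftAct (x ⊗ₜ[k] w) ⊗ₜ[k] y) := by
  induction w with
  | zero => simp only [map_zero, zero_tmul, tmul_zero]
  | add _ _ h1 h2 => simp only [map_add, add_tmul, tmul_add, h1, h2]
  | tmul => simp [leftAct_tmul, rightMul_rightMul]

theorem IsMatchedPair.leftAct_leftAct (x y : H) (w : A ⊗[k] H) :
    hmp.leftAct (x ⊗ₜ[k] hmp.leftAct (y ⊗ₜ[k] w)) =
      hmp.leftAct (hH.mul (x ⊗ₜ[k] y) ⊗ₜ[k] w) := by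
  induction w with
  | zero => simp only [map_zero, tmul_zero]
  | add _ _ h1 h2 => simp only [map_add, tmul_add, h1, h2]
  | tmul b z =>
    rw [leftAct_tmul, leftAct_tmul, leftAct_rightMul, exchange_mul_left]
    rfl

theorem IsMatchedPair.bicrossedMul_rightMul (v w : A ⊗[k] H) (y : H) :
    hmp.bicrossedMul (v ⊗ₜ[k] rightMul hH (w ⊗ₜ[k] y)) =
      rightMul hH (hmp.bicrossedMul (v ⊗ₜ[k] w) ⊗ₜ[k] y) := by
  induction v with
  | zero => simp only [map_zero, zero_tmul]
  | add _ _ h1 h2 => simp only [map_add, add_tmul, h1, h2]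
  | tmul => simp [bicrossedMul_tmul, leftAct_rightMul, leftMul_rightMul]

theorem IsMatchedPair.bicrossedMul_leftMul (a : A) (v w : A ⊗[k] H) :
    hmp.bicrossedMul (leftMul hA (a ⊗ₜ[k] v) ⊗ₜ[k] w) =
      leftMul hA (a ⊗ₜ[k] hmp.bicrossedMul (v ⊗ₜ[k] w)) := by
  induction v with
  | zero => simp only [map_zero, zero_tmul, tmul_zero]
  | add _ _ h1 h2 => simp only [map_add, add_tmul, tmul_add, h1, h2]
  | tmul => simp [bicrossedMul_tmul, leftMul_leftMul]

theorem IsMatchedPair.leftAct_leftMul (x : H) (b : A) (w : A ⊗[k] H) :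
    hmp.leftAct (x ⊗ₜ[k] leftMul hA (b ⊗ₜ[k] w)) =
      hmp.bicrossedMul (hmp.exchange (x ⊗ₜ[k] b) ⊗ₜ[k] w) := by
  induction w with
  | zero => simp only [map_zero, tmul_zero]
  | add _ _ h1 h2 => simp only [map_add, tmul_add, h1, h2]
  | tmul c z =>
    rw [leftMul_tmul, leftAct_tmul, exchange_mul_right]
    induction hmp.exchange (x ⊗ₜ[k] b) with
    | zero => simp only [map_zero, zero_tmul]
    | add _ _ h1 h2 => simp only [map_add, add_tmul, h1, h2]
    | tmul => simp [bicrossedMul_tmul, leftAct_tmul, leftMul_rightMul]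

theorem IsMatchedPair.bicrossedMul_rightMul_left (v : A ⊗[k] H) (y : H) (w : A ⊗[k] H) :
    hmp.bicrossedMul (rightMul hH (v ⊗ₜ[k] y) ⊗ₜ[k] w) =
      hmp.bicrossedMul (v ⊗ₜ[k] hmp.leftAct (y ⊗ₜ[k] w)) := by
  induction v with
  | zero => simp only [map_zero, zero_tmul]
  | add _ _ h1 h2 => simp only [map_add, add_tmul, h1, h2]
  | tmul => simp [bicrossedMul_tmul, leftAct_leftAct]

theorem IsMatchedPair.bicrossedMul_assoc (u v w : A ⊗[k] H) :
    hmp.bicrossedMul (hmp.bicrossedMul (u ⊗ₜ[k] v) ⊗ₜ[k] w) =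
      hmp.bicrossedMul (u ⊗ₜ[k] hmp.bicrossedMul (v ⊗ₜ[k] w)) := by
  induction u with
  | zero => simp only [map_zero, zero_tmul]
  | add _ _ h1 h2 => simp only [map_add, add_tmul, h1, h2]
  | tmul a x =>
    induction v with
    | zero => simp only [map_zero, zero_tmul, tmul_zero]
    | add _ _ h1 h2 => simp only [map_add, add_tmul, tmul_add, h1, h2]
    | tmul b y =>
      rw [bicrossedMul_tmul, bicrossedMul_tmul, bicrossedMul_leftMul, bicrossedMul_tmul,
        leftAct_leftMul, leftAct_tmul, bicrossedMul_rightMul_left]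

theorem IsMatchedPair.exchange_one_left (b : A) :
    hmp.exchange (hH.one ⊗ₜ[k] b) = b ⊗ₜ[k] hH.one := by
  have h : ∀ t : A ⊗[k] A, TensorProduct.map tri quad
      (TensorProduct.tensorTensorTensorComm k H H A A ((hH.one ⊗ₜ[k] hH.one) ⊗ₜ[k] t)) =
        TensorProduct.rid k A (lTensor A counit t) ⊗ₜ[k] hH.one := by
    intro t
    induction t with
    | zero => simp only [map_zero, tmul_zero, zero_tmul]
    | add _ _ h1 h2 => simp only [map_add, tmul_add, add_tmul, h1, h2]
    | tmul => simp [hmp.tri_module.one_act, hmp.mp1', smul_tmul]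
  rw [exchange_tmul, matchedEl, split, hH.comul_one, h]
  simp

theorem IsMatchedPair.exchange_one_right (x : H) :
    hmp.exchange (x ⊗ₜ[k] hA.one) = hA.one ⊗ₜ[k] x := by
  have h : ∀ t : H ⊗[k] H, TensorProduct.map tri quad
      (TensorProduct.tensorTensorTensorComm k H H A A (t ⊗ₜ[k] (hA.one ⊗ₜ[k] hA.one))) =
        hA.one ⊗ₜ[k] TensorProduct.lid k H (rTensor H counit t) := by
    intro t
    induction t with
    | zero => simp only [map_zero, tmul_zero, zero_tmul]
    | add _ _ h1 h2 => simp only [map_add, tmul_add, add_tmul, h1, h2]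
    | tmul => simp [hmp.quad_module.act_one, hmp.mp1, smul_tmul]
  rw [exchange_tmul, matchedEl, split, hA.comul_one, h]
  simp

theorem leftMul_one (w : A ⊗[k] H) : leftMul hA (hA.one ⊗ₜ[k] w) = w := by
  induction w with
  | zero => simp only [map_zero, tmul_zero]
  | add _ _ h1 h2 => simp only [map_add, tmul_add, h1, h2]
  | tmul => simp [hA.one_mul]

theorem rightMul_one (w : A ⊗[k] H) : rightMul hH (w ⊗ₜ[k] hH.one) = w := by
  induction w with
  | zero => simp only [map_zero, zero_tmul]
  | add _ _ h1 h2 => simp only [map_add, add_tmul, h1, h2]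
  | tmul => simp [hH.mul_one]

theorem IsMatchedPair.leftAct_one (w : A ⊗[k] H) : hmp.leftAct (hH.one ⊗ₜ[k] w) = w := by
  induction w with
  | zero => simp only [map_zero, tmul_zero]
  | add _ _ h1 h2 => simp only [map_add, tmul_add, h1, h2]
  | tmul => simp [leftAct_tmul, exchange_one_left, hH.one_mul]

theorem IsMatchedPair.leftAct_one_tmul (x y : H) :
    hmp.leftAct (x ⊗ₜ[k] (hA.one ⊗ₜ[k] y)) = hA.one ⊗ₜ[k] hH.mul (x ⊗ₜ[k] y) := by
  rw [leftAct_tmul, exchange_one_right, rightMul_tmul]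

theorem IsMatchedPair.leftAct_tmul_one (x : H) (b : A) :
    hmp.leftAct (x ⊗ₜ[k] (b ⊗ₜ[k] hH.one)) = hmp.exchange (x ⊗ₜ[k] b) := by
  rw [leftAct_tmul, rightMul_one]

/-- The bicrossed product of a matched pair of Hopf algebras. -/
noncomputable def IsMatchedPair.bicrossed : HopfStr k (A ⊗[k] H) where
  mul := (hmp.bicrossedMul : (A ⊗[k] H) ⊗[k] (A ⊗[k] H) →ₗ[k] A ⊗[k] H)
  one := hA.one ⊗ₜ[k] hH.one
  mul_assoc := hmp.bicrossedMul_assoc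
  one_mul w := by
    rw [CoalgHom.coe_toLinearMap, bicrossedMul_tmul, leftAct_one, leftMul_one]
  mul_one w := by
    induction w with
    | zero => simp only [map_zero, zero_tmul]
    | add _ _ h1 h2 => simp only [map_add, add_tmul, h1, h2]
    | tmul =>
      rw [CoalgHom.coe_toLinearMap, bicrossedMul_tmul, leftAct_one_tmul, leftMul_tmul,
        hA.mul_one, hH.mul_one]
  comul_mul u v := (CoalgHomClass.map_comp_comul_apply hmp.bicrossedMul (u ⊗ₜ[k] v)).symm
  counit_mul u v := by
    rw [CoalgHom.coe_toLinearMap, CoalgHomClass.counit_comp_apply, TensorProduct.counit_tmul,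
      smul_eq_mul, mul_comm]
  comul_one := comul_one_tmul_one hA hH
  counit_one := counit_one_tmul_one hA hH
  antipode := (hmp.exchange : H ⊗[k] A →ₗ[k] A ⊗[k] H) ∘ₗ
    TensorProduct.map hH.antipode hA.antipode ∘ₗ (TensorProduct.comm k A H).toLinearMap
  antipode_left := TensorProduct.ext' fun a x => by
    have r := Repr.arbitrary k a
    have s := Repr.arbitrary k x
    simp only [LinearMap.comp_apply, comul_tmul_repr r s, map_sum, rTensor_tmul, map_tmul,
      LinearEquiv.coe_coe, comm_tmul, CoalgHom.coe_toLinearMap, ← leftAct_leftMul,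
      leftMul_tmul, TensorProduct.counit_tmul, toSpanSingleton_apply, smul_eq_mul]
    rw [Finset.sum_comm]
    simp only [← map_sum, ← tmul_sum, ← sum_tmul, hA.sum_antipode_mul]
    simp only [← smul_tmul', tmul_smul]
    rw [← Finset.smul_sum, map_smul, map_sum]
    simp only [leftAct_one_tmul]
    rw [← tmul_sum, hH.sum_antipode_mul, tmul_smul, smul_smul, mul_comm]
  antipode_right := TensorProduct.ext' fun a x => by
    have r := Repr.arbitrary k a
    have s := Repr.arbitrary k x
    simp only [LinearMap.comp_apply, comul_tmul_repr r s, map_sum, lTensor_tmul, map_tmul,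
      LinearEquiv.coe_coe, comm_tmul, CoalgHom.coe_toLinearMap, bicrossedMul_tmul,
      ← leftAct_tmul_one, leftAct_leftAct, TensorProduct.counit_tmul,
      toSpanSingleton_apply, smul_eq_mul]
    simp only [← map_sum, ← tmul_sum, ← sum_tmul, hH.sum_mul_antipode]
    simp only [← smul_tmul', map_smul, leftAct_one, tmul_smul]
    rw [← Finset.smul_sum, map_smul, map_sum]
    simp only [leftMul_tmul]
    rw [← sum_tmul, hA.sum_mul_antipode, ← smul_tmul', smul_smul]

theorem IsMatchedPair.bicrossed_mul (z : (A ⊗[k] H) ⊗[k] (A ⊗[k] H)) :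
    hmp.bicrossed.mul z = hmp.bicrossedMul z := rfl

theorem IsMatchedPair.bicrossed_antipode_tmul (a : A) (x : H) :
    hmp.bicrossed.antipode (a ⊗ₜ[k] x) = hmp.exchange (hH.antipode x ⊗ₜ[k] hA.antipode a) := rfl

theorem IsMatchedPair.bicrossedMul_eq_sandwich (a b : A) (x y : H) :
    hmp.bicrossedMul ((a ⊗ₜ[k] x) ⊗ₜ[k] (b ⊗ₜ[k] y)) =
      sandwich k hA.mul hH.mul ((a ⊗ₜ[k] matchedEl tri quad x b) ⊗ₜ[k] y) := by
  rw [bicrossedMul_tmul, leftAct_tmul, exchange_tmul]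
  induction matchedEl tri quad x b with
  | zero => simp only [map_zero, zero_tmul, tmul_zero]
  | add _ _ h1 h2 => simp only [map_add, add_tmul, tmul_add, h1, h2]
  | tmul => rfl

theorem tensorMul_op_tmul (hH' : IsCocomm k H) (a : A) (g : H) (w : A ⊗[k] H) :
    hA.tensorMul (hH.op hH') ((a ⊗ₜ[k] g) ⊗ₜ[k] w) =
      leftMul hA (a ⊗ₜ[k] rightMul hH (w ⊗ₜ[k] g)) := by
  induction w with
  | zero => simp only [map_zero, zero_tmul, tmul_zero]
  | add _ _ h1 h2 => simp only [map_add, add_tmul, tmul_add, h1, h2]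
  | tmul => rfl

theorem braceRHS_tmul {V : Type u} [AddCommGroup V] [Module k V] [Coalgebra k V]
    (m : V ⊗[k] V →ₗ[k] V) (S : V →ₗ[k] V) (m' : V ⊗[k] V →ₗ[k] V) {x : V} (y z : V)
    {ι : Type*} {κ : ι → Type*} (r : Repr k x ι) (s : (i : ι) → Repr k (r.right i) (κ i)) :
    braceRHS m S m' (x ⊗ₜ[k] (y ⊗ₜ[k] z)) = ∑ i ∈ r.index, ∑ j ∈ (s i).index,
      m (m' (r.left i ⊗ₜ[k] y) ⊗ₜ[k]
        m (S ((s i).left j) ⊗ₜ[k] m' ((s i).right j ⊗ₜ[k] z))) := by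
  rw [braceRHS]
  simp only [LinearMap.comp_apply, rTensor_tmul]
  rw [← r.eq]
  simp only [map_sum, sum_tmul, lTensor_tmul]
  refine Finset.sum_congr rfl fun i _ => ?_
  rw [← (s i).eq]
  simp only [map_sum, sum_tmul, tmul_sum]
  rfl

/-- The representative of `Δ(a ⊗ b)` assembled from representatives of `Δ(a)` and `Δ(b)`. -/
noncomputable def reprTmul {a : A} {b : H} {ι κ : Type*} (r : Repr k a ι) (s : Repr k b κ) :
    Repr k (a ⊗ₜ[k] b) (ι × κ) where
  index := r.index ×ˢ s.index
  left p := r.left p.1 ⊗ₜ[k] s.left p.2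
  right p := r.right p.1 ⊗ₜ[k] s.right p.2
  eq := by rw [Finset.sum_product, comul_tmul_repr r s]

theorem IsMatchedPair.brace_bicrossed_tmul (hH' : IsCocomm k H) (a b c : A) (g h l : H) :
    hA.tensorMul (hH.op hH') ((a ⊗ₜ[k] g) ⊗ₜ[k]
        hmp.bicrossedMul ((b ⊗ₜ[k] h) ⊗ₜ[k] (c ⊗ₜ[k] l))) =
      braceRHS hmp.bicrossed.mul hmp.bicrossed.antipode (hA.tensorMul (hH.op hH'))
        ((a ⊗ₜ[k] g) ⊗ₜ[k] ((b ⊗ₜ[k] h) ⊗ₜ[k] (c ⊗ₜ[k] l))) := by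
  let r := Repr.arbitrary k a
  let s := Repr.arbitrary k g
  let r' := fun i => Repr.arbitrary k (r.right i)
  let s' := fun j => Repr.arbitrary k (s.right j)
  let Φ : (A ⊗[k] A) ⊗[k] (H ⊗[k] H) →ₗ[k] A ⊗[k] H :=
    (hmp.bicrossedMul : (A ⊗[k] H) ⊗[k] (A ⊗[k] H) →ₗ[k] A ⊗[k] H) ∘ₗ
      TensorProduct.map
        (TensorProduct.map (hA.mul ∘ₗ (TensorProduct.mk k A A).flip b)
          (hH.mul ∘ₗ TensorProduct.mk k H H h))
        (TensorProduct.map (hA.mul ∘ₗ (TensorProduct.mk k A A).flip c)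
          (hH.mul ∘ₗ TensorProduct.mk k H H l)) ∘ₗ
      (TensorProduct.tensorTensorTensorComm k A A H H).toLinearMap
  have hΦ : ∀ (a₁ a₂ : A) (g₁ g₂ : H), Φ ((a₁ ⊗ₜ[k] a₂) ⊗ₜ[k] (g₁ ⊗ₜ[k] g₂)) =
      hmp.bicrossedMul ((hA.mul (a₁ ⊗ₜ[k] b) ⊗ₜ[k] hH.mul (h ⊗ₜ[k] g₁)) ⊗ₜ[k]
        (hA.mul (a₂ ⊗ₜ[k] c) ⊗ₜ[k] hH.mul (l ⊗ₜ[k] g₂))) := fun _ _ _ _ => rfl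
  have hterm : ∀ (a₁ a₂ a₃ : A) (g₁ g₂ g₃ : H),
      hmp.bicrossedMul ((hA.mul (a₁ ⊗ₜ[k] b) ⊗ₜ[k] hH.mul (h ⊗ₜ[k] g₁)) ⊗ₜ[k]
        hmp.bicrossedMul (hmp.exchange (hH.antipode g₂ ⊗ₜ[k] hA.antipode a₂) ⊗ₜ[k]
          (hA.mul (a₃ ⊗ₜ[k] c) ⊗ₜ[k] hH.mul (l ⊗ₜ[k] g₃)))) =
      Φ ((a₁ ⊗ₜ[k] hA.mul (hA.antipode a₂ ⊗ₜ[k] a₃)) ⊗ₜ[k]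
        (hH.mul (g₁ ⊗ₜ[k] hH.antipode g₂) ⊗ₜ[k] g₃)) := by
    intro a₁ a₂ a₃ g₁ g₂ g₃
    rw [← leftAct_leftMul, ← bicrossedMul_rightMul_left, leftMul_tmul, rightMul_tmul, hΦ,
      hH.mul_assoc, hA.mul_assoc]
  rw [braceRHS_tmul _ _ _ _ _ (reprTmul r s) fun p => reprTmul (r' p.1) (s' p.2)]
  simp only [reprTmul, Finset.sum_product, bicrossed_mul, bicrossed_antipode_tmul,
    tensorMul_op_tmul, rightMul_tmul, leftMul_tmul, hterm]
  have h1 := hA.sum_tmul_antipode_mul r r'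
  have h2 := hH.sum_mul_antipode_tmul s s'
  trans Φ ((a ⊗ₜ[k] hA.one) ⊗ₜ[k] (hH.one ⊗ₜ[k] g))
  · rw [hΦ, hA.one_mul, hH.mul_one, ← bicrossedMul_rightMul, ← bicrossedMul_leftMul,
      leftMul_tmul, rightMul_tmul]
  · rw [← h1, ← h2]
    simp only [sum_tmul, tmul_sum, map_sum]
    conv_rhs => rw [Finset.sum_comm]
    refine Finset.sum_congr rfl fun j _ => ?_
    rw [Finset.sum_comm]
    exact Finset.sum_congr rfl fun i _ => Finset.sum_comm

theorem IsMatchedPair.brace_bicrossed (hH' : IsCocomm k H) :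
    hA.tensorMul (hH.op hH') ∘ₗ lTensor (A ⊗[k] H) hmp.bicrossed.mul =
      braceRHS hmp.bicrossed.mul hmp.bicrossed.antipode (hA.tensorMul (hH.op hH')) := by
  refine TensorProduct.ext_threefold' fun u v w => ?_
  induction u with
  | zero => simp only [map_zero, zero_tmul]
  | add _ _ h1 h2 => simp only [map_add, add_tmul, h1, h2]
  | tmul a g =>
  induction v with
  | zero => simp only [map_zero, zero_tmul, tmul_zero]
  | add _ _ h1 h2 => simp only [map_add, add_tmul, tmul_add, h1, h2]
  | tmul b h =>
  induction w with
  | zero => simp only [map_zero, tmul_zero]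
  | add _ _ h1 h2 => simp only [map_add, tmul_add, h1, h2]
  | tmul c l => exact hmp.brace_bicrossed_tmul hH' a b c g h l

end Bicrossed

/-- Corollary `11.11`. If `(A, H, ▷, ◁)` is a matched pair of Hopf algebras
with `H` cocommutative, then the tensor product coalgebra `A ⊗ H` with the bicrossed product
multiplication `(a ⊗ x)(b ⊗ y) = a(x₍₁₎ ▷ b₍₁₎) ⊗ (x₍₂₎ ◁ b₍₂₎)y` and
`(a ⊗ x) ∘ (b ⊗ y) = ab ⊗ yx` is a Hopf brace. -/
theorem statement4 {k : Type u} [Field k]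
    {A H : Type u} [AddCommGroup A] [Module k A] [Coalgebra k A]
    [AddCommGroup H] [Module k H] [Coalgebra k H]
    (hA : HopfStr k A) (hH : HopfStr k H) (hHcocomm : IsCocomm k H)
    (tri : H ⊗[k] A →ₗ[k] A) (quad : H ⊗[k] A →ₗ[k] H)
    (hmp : IsMatchedPair hA hH tri quad) :
    ∃ B : HopfBrace k (A ⊗[k] H),
      (∀ (a b : A) (x y : H),
        B.dot.mul ((a ⊗ₜ[k] x) ⊗ₜ[k] (b ⊗ₜ[k] y)) =
          sandwich k hA.mul hH.mul ((a ⊗ₜ[k] matchedEl tri quad x b) ⊗ₜ[k] y)) ∧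
      (∀ (a b : A) (x y : H),
        B.circ.mul ((a ⊗ₜ[k] x) ⊗ₜ[k] (b ⊗ₜ[k] y)) =
          hA.mul (a ⊗ₜ[k] b) ⊗ₜ[k] hH.mul (y ⊗ₜ[k] x)) := by
  refine ⟨⟨hmp.bicrossed, hA.tensor (hH.op hHcocomm), hmp.brace_bicrossed hHcocomm⟩, ?_, ?_⟩
  · exact hmp.bicrossedMul_eq_sandwich
  · exact fun _ _ _ _ => rfl

end HopfBraceNL
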